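/- For every sequence (c_n) of real numbers there exists an ε > 0 and an infinitely differentiable function σ : ℝ → ℝ such that for every natural number n the n-th derivative of σ at 0 equals c_n. -/

import Mathlib

open Filter Topology in
/-- Monomials can be cut off to compactly supported smooth functions with the same jet at `0`. -/
theorem exists_contDiff_hasCompactSupport_iteratedDeriv_zero (n : ℕ) :
    ∃ g : ℝ → ℝ, ContDiff ℝ (⊤ : ℕ∞) g ∧ HasCompactSupport g ∧
      ∀ k : ℕ, iteratedDeriv k g 0 = if k = n then 1 else 0 := by
  let b : ContDiffBump (0 : ℝ) := ⟨1, 2, one_pos, one_lt_two⟩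
  refine ⟨fun x ↦ b x * ((n.factorial : ℝ)⁻¹ * x ^ n),
    b.contDiff.mul (contDiff_const.mul (contDiff_id.pow n)), b.hasCompactSupport.mul_right,
    fun k ↦ ?_⟩
  have heq : (fun x : ℝ ↦ b x * ((n.factorial : ℝ)⁻¹ * x ^ n)) =ᶠ[𝓝 0]
      fun x ↦ (n.factorial : ℝ)⁻¹ * x ^ n := by
    filter_upwards [b.eventuallyEq_one] with x hx
    simp [hx]
  rw [heq.iteratedDeriv_eq, iteratedDeriv_const_mul_field, iteratedDeriv_fun_pow_zero]
  split_ifs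
  · simp [Nat.factorial_ne_zero]
  · simp

/-- The derivatives of a smooth compactly supported function are bounded. -/
theorem HasCompactSupport.exists_bound_iteratedDeriv {g : ℝ → ℝ} (hs : HasCompactSupport g)
    (hg : ContDiff ℝ (⊤ : ℕ∞) g) (k : ℕ) : ∃ M : ℝ, ∀ x, ‖iteratedDeriv k g x‖ ≤ M := by
  obtain ⟨M, hM⟩ := (hs.iteratedFDeriv k).exists_bound_of_continuous
    (hg.continuous_iteratedFDeriv (m := k) (mod_cast le_top))
  exact ⟨M, fun x ↦ norm_iteratedFDeriv_eq_norm_iteratedDeriv (𝕜 := ℝ) (f := g) ▸ hM x⟩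

/-- A smooth function whose jet at `0` is `a xⁿ / n!` and whose derivatives of order less than `n`
are uniformly small. -/
theorem exists_contDiff_iteratedDeriv_zero_of_small (n : ℕ) (a : ℝ) {δ : ℝ} (hδ : 0 < δ) :
    ∃ f : ℝ → ℝ, ContDiff ℝ (⊤ : ℕ∞) f ∧
      (∀ k : ℕ, iteratedDeriv k f 0 = if k = n then a else 0) ∧
      (∀ k : ℕ, ∃ M : ℝ, ∀ x, ‖iteratedDeriv k f x‖ ≤ M) ∧
      ∀ k < n, ∀ x, ‖iteratedDeriv k f x‖ ≤ δ := by
  obtain ⟨g, hg, hs, hg0⟩ := exists_contDiff_hasCompactSupport_iteratedDeriv_zero n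
  choose M hM using hs.exists_bound_iteratedDeriv hg
  have hM0 (k : ℕ) : 0 ≤ M k := (norm_nonneg _).trans (hM k 0)
  set S := ∑ k ∈ Finset.range n, M k
  have hS : 0 ≤ S := Finset.sum_nonneg fun k _ ↦ hM0 k
  set L := 1 + |a| * S / δ
  have hL : 1 ≤ L := le_add_of_nonneg_right (by positivity)
  have hL0 : 0 < L := one_pos.trans_le hL
  have hderiv (k : ℕ) (x : ℝ) : iteratedDeriv k (fun x ↦ a * (L ^ n)⁻¹ * g (L * x)) x =
      a * (L ^ n)⁻¹ * (L ^ k * iteratedDeriv k g (L * x)) := by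
    rw [iteratedDeriv_const_mul_field, iteratedDeriv_comp_const_mul (hg.of_le (mod_cast le_top))]
  have hnorm (k : ℕ) (x : ℝ) : ‖iteratedDeriv k (fun x ↦ a * (L ^ n)⁻¹ * g (L * x)) x‖ ≤
      |a| * (L ^ n)⁻¹ * (L ^ k * M k) := by
    rw [hderiv, norm_mul, norm_mul, norm_mul, Real.norm_eq_abs a,
      Real.norm_of_nonneg (by positivity : 0 ≤ (L ^ n)⁻¹),
      Real.norm_of_nonneg (by positivity : 0 ≤ L ^ k)]
    gcongr
    exact hM k _
  refine ⟨fun x ↦ a * (L ^ n)⁻¹ * g (L * x),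
    contDiff_const.mul (hg.comp (contDiff_const.mul contDiff_id)), fun k ↦ ?_,
    fun k ↦ ⟨_, hnorm k⟩, fun k hk x ↦ (hnorm k x).trans ?_⟩
  · rw [hderiv, mul_zero, hg0]
    split_ifs with h
    · subst h
      field_simp
    · simp
  · have hpow : L ^ k * L ≤ L ^ n := by
      rw [← pow_succ]
      exact pow_le_pow_right₀ hL hk
    have hMS : M k ≤ S :=
      Finset.single_le_sum (fun i _ ↦ hM0 i) (Finset.mem_range.2 hk)
    have hSL : |a| * S ≤ δ * L := by
      have : δ * L = δ + |a| * S := by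
        simp only [L]
        field_simp
      linarith
    calc |a| * (L ^ n)⁻¹ * (L ^ k * M k) = |a| * M k * L ^ k / L ^ n := by ring
      _ ≤ δ := by
        rw [div_le_iff₀ (by positivity)]
        calc |a| * M k * L ^ k ≤ |a| * S * L ^ k := by gcongr
          _ ≤ δ * L * L ^ k := by gcongr
          _ = δ * (L ^ k * L) := by ring
          _ ≤ δ * L ^ n := by gcongr

/-- Borel's theorem: for every real sequence `(cₙ)` there exist `ε > 0` and a smooth
function `σ : ℝ → ℝ` whose `n`-th derivative at `0` equals `cₙ` for every `n`. -/
theorem borel_theorem (c : ℕ → ℝ) :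
    ∃ ε : ℝ, 0 < ε ∧ ∃ σ : ℝ → ℝ, ContDiff ℝ (⊤ : ℕ∞) σ ∧
      ∀ n : ℕ, iteratedDeriv n σ 0 = c n := by
  choose f hf hf0 hbdd hsmall using fun n ↦
    exists_contDiff_iteratedDeriv_zero_of_small n (c n) (δ := (1 / 2 : ℝ) ^ n) (by positivity)
  choose M hM using hbdd
  let v (k n : ℕ) : ℝ := if k < n then (1 / 2) ^ n else M n k
  have hv (k : ℕ) : Summable (v k) := by
    refine summable_geometric_two.congr_atTop ?_
    filter_upwards [Filter.eventually_gt_atTop k] with n hn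
    simp [v, hn]
  have hfv (k n : ℕ) (x : ℝ) : ‖iteratedFDeriv ℝ k (f n) x‖ ≤ v k n := by
    rw [norm_iteratedFDeriv_eq_norm_iteratedDeriv]
    by_cases h : k < n
    · simpa only [v, if_pos h] using hsmall n k h x
    · simpa only [v, if_neg h] using hM n k x
  refine ⟨1, one_pos, fun x ↦ ∑' n, f n x,
    contDiff_tsum hf (fun k _ ↦ hv k) fun k n x _ ↦ hfv k n x, fun k ↦ ?_⟩
  have hsum : Summable fun n ↦ iteratedFDeriv ℝ k (f n) 0 :=
    .of_norm_bounded (hv k) fun n ↦ hfv k n 0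
  rw [iteratedDeriv_eq_iteratedFDeriv,
    iteratedFDeriv_tsum_apply hf (fun k _ ↦ hv k) (fun k n x _ ↦ hfv k n x) (mod_cast le_top),
    ContinuousMultilinearMap.tsum_eval hsum]
  simp_rw [← iteratedDeriv_eq_iteratedFDeriv, hf0]
  simp
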